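/- Semi-weak C-regular implies C-regular: Let Ω ⊆ ℍ be a bounded open set whose closure is disjoint from the plane {t + zk : t, z ∈ ℝ}, and let f : ℍ → ℍ be continuously differentiable on Ω. Suppose f is semi-weak C-regular on Ω, i.e. for every test function φ on Ω, ∫_Ω (D_r φ)(q)·f(q) dV(q) = ∫_Ω φ(q)·( (1/r(q))·(∂f/∂ι)(q) ) dV(q). Then f is C-regular in the classical sense: ∂f/∂t + ι·(∂f/∂r) = 0 at every point of Ω. -/

import Mathlib

open MeasureTheory Metric Filter
open scoped Quaternion Topology

noncomputable section

/-- Borel measurable structure on the quaternions `ℍ ≅ ℝ⁴`. -/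
instance : MeasurableSpace ℍ[ℝ] := borel _
instance : BorelSpace ℍ[ℝ] := ⟨rfl⟩

/-- Lebesgue measure on `ℍ ≅ ℝ⁴`, i.e. the Haar measure normalized so that the unit cube
of an orthonormal basis has volume one. -/
instance : MeasureSpace ℍ[ℝ] := ⟨(stdOrthonormalBasis ℝ ℍ[ℝ]).toBasis.addHaar⟩

/-- The imaginary unit `i` of `ℍ`. -/
def qI : ℍ[ℝ] := ⟨0, 1, 0, 0⟩
/-- The imaginary unit `j` of `ℍ`. -/
def qJ : ℍ[ℝ] := ⟨0, 0, 1, 0⟩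
/-- The imaginary unit `k` of `ℍ`. -/
def qK : ℍ[ℝ] := ⟨0, 0, 0, 1⟩

/-- The left Fueter operator `D_l f = ∂f/∂t + i·∂f/∂x + j·∂f/∂y + k·∂f/∂z`. -/
def Dl (f : ℍ[ℝ] → ℍ[ℝ]) (q : ℍ[ℝ]) : ℍ[ℝ] :=
  fderiv ℝ f q 1 + qI * fderiv ℝ f q qI + qJ * fderiv ℝ f q qJ + qK * fderiv ℝ f q qK

/-- The right Fueter operator `D_r f = ∂f/∂t + (∂f/∂x)·i + (∂f/∂y)·j + (∂f/∂z)·k`. -/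
def Dr (f : ℍ[ℝ] → ℍ[ℝ]) (q : ℍ[ℝ]) : ℍ[ℝ] :=
  fderiv ℝ f q 1 + fderiv ℝ f q qI * qI + fderiv ℝ f q qJ * qJ + fderiv ℝ f q qK * qK

/-- The Cauchy–Fueter kernel `E(q,p) = (1/(2π²))·(q−p)⁻¹/|q−p|²`. -/
def E (q p : ℍ[ℝ]) : ℍ[ℝ] := ((2 * Real.pi ^ 2)⁻¹ * (‖q - p‖ ^ 2)⁻¹) • (q - p)⁻¹

/-- A test function on a bounded open set `Ω ⊆ ℍ`: a smooth function with compact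
support contained in `Ω`. -/
structure IsTestFunction (φ : ℍ[ℝ] → ℍ[ℝ]) (Ω : Set ℍ[ℝ]) : Prop where
  smooth : ContDiff ℝ (⊤ : ℕ∞) φ
  compact_supp : HasCompactSupport φ
  supp_subset : tsupport φ ⊆ Ω

/-- `r(q) = |Im q|`. -/
def rQ (q : ℍ[ℝ]) : ℝ := ‖q.im‖

/-- `ι(q) = Im q / |Im q|`. -/
def iotaQ (q : ℍ[ℝ]) : ℍ[ℝ] := (rQ q)⁻¹ • q.im

/-- `sqrt(x² + y²)`, so that `sin β = sXY q / r q`. -/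
def sXY (q : ℍ[ℝ]) : ℝ := Real.sqrt (q.imI ^ 2 + q.imJ ^ 2)

/-- `ι_α = (−sin α sin β)i + (cos α sin β)j`, expressed through the coordinates of `q`. -/
def iotaA (q : ℍ[ℝ]) : ℍ[ℝ] := ⟨0, -(q.imJ / rQ q), q.imI / rQ q, 0⟩

/-- `ι_β = (cos α cos β)i + (sin α cos β)j − (sin β)k`, expressed through the
coordinates of `q`. -/
def iotaB (q : ℍ[ℝ]) : ℍ[ℝ] :=
  ⟨0, q.imI * q.imK / (sXY q * rQ q), q.imJ * q.imK / (sXY q * rQ q), -(sXY q / rQ q)⟩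

/-- `∂f/∂ι := ι_α⁻¹·(∂f/∂α) + ι_β⁻¹·(∂f/∂β)`, where `∂f/∂α = f'(q)(r·ι_α)` and
`∂f/∂β = f'(q)(r·ι_β)`. -/
def dIota (f : ℍ[ℝ] → ℍ[ℝ]) (q : ℍ[ℝ]) : ℍ[ℝ] :=
  (iotaA q)⁻¹ * fderiv ℝ f q (rQ q • iotaA q) + (iotaB q)⁻¹ * fderiv ℝ f q (rQ q • iotaB q)

/-- The plane `{t + zk : t, z ∈ ℝ} ⊆ ℍ`. -/
def tkPlane : Set ℍ[ℝ] := {q | q.imI = 0 ∧ q.imJ = 0}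

instance : (volume : Measure ℍ[ℝ]).IsAddHaarMeasure :=
  inferInstanceAs (stdOrthonormalBasis ℝ ℍ[ℝ]).toBasis.addHaar.IsAddHaarMeasure

/-- The left Cullen operator `∂f/∂t + ι·∂f/∂r`. -/
def cullen (f : ℍ[ℝ] → ℍ[ℝ]) (q : ℍ[ℝ]) : ℍ[ℝ] :=
  fderiv ℝ f q 1 + iotaQ q * fderiv ℝ f q (iotaQ q)

theorem rQ_sq (q : ℍ[ℝ]) : rQ q ^ 2 = q.imI ^ 2 + q.imJ ^ 2 + q.imK ^ 2 := by
  rw [rQ, sq, ← Quaternion.normSq_eq_norm_mul_self, Quaternion.normSq_def']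
  simp

theorem sXY_sq (q : ℍ[ℝ]) : sXY q ^ 2 = q.imI ^ 2 + q.imJ ^ 2 :=
  Real.sq_sqrt (by positivity)

theorem sXY_ne_zero {q : ℍ[ℝ]} (hq : q ∉ tkPlane) : sXY q ≠ 0 := by
  intro h
  have h2 := sXY_sq q
  rw [h] at h2
  exact hq ⟨by nlinarith [sq_nonneg q.imI, sq_nonneg q.imJ],
    by nlinarith [sq_nonneg q.imI, sq_nonneg q.imJ]⟩

theorem rQ_ne_zero {q : ℍ[ℝ]} (hq : q ∉ tkPlane) : rQ q ≠ 0 := by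
  intro h
  have h2 := rQ_sq q
  have h3 := sXY_sq q
  have h4 : 0 < sXY q ^ 2 := by have := sXY_ne_zero hq; positivity
  rw [h] at h2
  nlinarith [sq_nonneg q.imK]

theorem quaternion_eq_smul_of_re_eq_zero (a b c : ℝ) :
    (⟨0, a, b, c⟩ : ℍ[ℝ]) = a • qI + b • qJ + c • qK := by
  ext <;> simp <;> simp [qI, qJ, qK]

theorem iotaQ_eq (q : ℍ[ℝ]) :
    iotaQ q = (q.imI / rQ q) • qI + (q.imJ / rQ q) • qJ + (q.imK / rQ q) • qK := by
  ext <;> simp [iotaQ] <;> simp [qI, qJ, qK] <;> ring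

theorem iotaA_inv {q : ℍ[ℝ]} (hq : q ∉ tkPlane) :
    (iotaA q)⁻¹ = -((rQ q ^ 2 / sXY q ^ 2) • iotaA q) := by
  have hr := rQ_ne_zero hq
  have hs := sXY_ne_zero hq
  have hn : Quaternion.normSq (iotaA q) = sXY q ^ 2 / rQ q ^ 2 := by
    rw [Quaternion.normSq_def', sXY_sq]
    simp only [iotaA]
    field_simp
    ring
  rw [Quaternion.inv_def, hn, inv_div, Quaternion.star_eq_neg.2 rfl, smul_neg]

theorem iotaB_inv {q : ℍ[ℝ]} (hq : q ∉ tkPlane) : (iotaB q)⁻¹ = -iotaB q := by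
  have hr := rQ_ne_zero hq
  have hs := sXY_ne_zero hq
  have hn : Quaternion.normSq (iotaB q) = 1 := by
    rw [Quaternion.normSq_def']
    simp only [iotaB]
    field_simp
    linear_combination (-q.imK ^ 2) * sXY_sq q + (sXY q ^ 2) * sXY_sq q - (sXY q ^ 2) * rQ_sq q
  rw [Quaternion.inv_def, hn, inv_one, one_smul, Quaternion.star_eq_neg.2 rfl]

/-- Off the plane `{t + zk}`, the Fueter and Cullen operators differ by `r⁻¹ ∂/∂ι`. -/
theorem cullen_eq_Dl_add {q : ℍ[ℝ]} (hq : q ∉ tkPlane) (f : ℍ[ℝ] → ℍ[ℝ]) :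
    cullen f q = Dl f q + (rQ q)⁻¹ • dIota f q := by
  have hr := rQ_ne_zero hq
  have hs := sXY_ne_zero hq
  have hr2 := rQ_sq q
  have hs2 := sXY_sq q
  rw [cullen, Dl, dIota, iotaA_inv hq, iotaB_inv hq, iotaQ_eq, iotaA, iotaB]
  simp only [quaternion_eq_smul_of_re_eq_zero, map_add, map_smul]
  generalize fderiv ℝ f q qI = a
  generalize fderiv ℝ f q qJ = b
  generalize fderiv ℝ f q qK = c
  generalize rQ q = r at *
  generalize sXY q = s at *
  generalize q.imI = x at *
  generalize q.imJ = y at *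
  generalize q.imK = z at *
  simp only [add_mul, mul_add, smul_add, smul_smul, smul_mul_assoc, mul_smul_comm, neg_mul,
    smul_neg]
  match_scalars
  all_goals field_simp
  all_goals grind

theorem integral_fderiv_apply_eq_zero {F : ℍ[ℝ] → ℍ[ℝ]} (hF : ContDiff ℝ 1 F)
    (hc : HasCompactSupport F) (v : ℍ[ℝ]) :
    ∫ q, fderiv ℝ F q v = 0 := by
  have hi : Integrable (fun q => fderiv ℝ F q v) :=
    ((hF.continuous_fderiv one_ne_zero).clm_apply continuous_const).integrable_of_hasCompactSupport
      (hc.fderiv_apply ℝ v)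
  have h := integral_smul_fderiv_eq_neg_fderiv_smul_of_integrable (𝕜 := ℝ)
    (μ := (volume : Measure ℍ[ℝ])) (f := fun _ => (1 : ℝ)) (g := F) (v := v)
    (by simp) (by simpa using hi)
    (by simpa using hF.continuous.integrable_of_hasCompactSupport hc)
    (by simp) (fun x _ => hF.differentiable one_ne_zero x)
  simpa using h

theorem integrable_smul_of_continuousOn {Ω : Set ℍ[ℝ]} (hΩ : IsOpen Ω) {u : ℍ[ℝ] → ℝ}
    (hu : Continuous u) (hc : HasCompactSupport u) (hs : tsupport u ⊆ Ω) {h : ℍ[ℝ] → ℍ[ℝ]}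
    (hh : ContinuousOn h Ω) : Integrable (fun q => u q • h q) := by
  refine Continuous.integrable_of_hasCompactSupport ?_ hc.smul_right
  refine continuous_of_tsupport fun q hq => ?_
  exact hu.continuousAt.smul (hh.continuousAt (hΩ.mem_nhds (hs (tsupport_smul_subset_left u h hq))))

theorem contDiff_smul_of_contDiffOn {Ω : Set ℍ[ℝ]} (hΩ : IsOpen Ω) {u : ℍ[ℝ] → ℝ}
    (hu : ContDiff ℝ 1 u) (hs : tsupport u ⊆ Ω) {h : ℍ[ℝ] → ℍ[ℝ]}
    (hh : ContDiffOn ℝ 1 h Ω) : ContDiff ℝ 1 (fun q => u q • h q) := by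
  refine contDiff_iff_contDiffAt.2 fun q => ?_
  by_cases hq : q ∈ tsupport u
  · exact hu.contDiffAt.smul (hh.contDiffAt (hΩ.mem_nhds (hs hq)))
  · refine contDiffAt_const (c := (0 : ℍ[ℝ])).congr_of_eventuallyEq ?_
    filter_upwards [notMem_tsupport_iff_eventuallyEq.mp hq] with p hp
    simp [hp]

theorem Dr_smul_one {u : ℍ[ℝ] → ℝ} {q : ℍ[ℝ]} (hu : DifferentiableAt ℝ u q) :
    Dr (fun p => u p • (1 : ℍ[ℝ])) q = fderiv ℝ u q 1 • 1 + fderiv ℝ u q qI • qI +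
      fderiv ℝ u q qJ • qJ + fderiv ℝ u q qK • qK := by
  have h : fderiv ℝ (fun p => u p • (1 : ℍ[ℝ])) q = (fderiv ℝ u q).smulRight 1 :=
    fderiv_smul_const hu 1
  simp [Dr, h]

theorem Dl_smul {u : ℍ[ℝ] → ℝ} {f : ℍ[ℝ] → ℍ[ℝ]} {q : ℍ[ℝ]} (hu : DifferentiableAt ℝ u q)
    (hf : DifferentiableAt ℝ f q) :
    Dl (fun p => u p • f p) q = Dr (fun p => u p • (1 : ℍ[ℝ])) q * f q + u q • Dl f q := by
  rw [Dr_smul_one hu, Dl, fderiv_fun_smul hu hf, Dl]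
  simp only [FunLike.coe_add, Pi.add_apply, FunLike.coe_smul, Pi.smul_apply,
    ContinuousLinearMap.smulRight_apply, mul_add, add_mul, smul_add, mul_smul_comm,
    smul_mul_assoc, one_mul]
  abel

theorem integrable_Dl {F : ℍ[ℝ] → ℍ[ℝ]} (hF : ContDiff ℝ 1 F) (hc : HasCompactSupport F) :
    Integrable (Dl F) ∧ ∫ q, Dl F q = 0 := by
  have hi : ∀ v, Integrable (fun q => fderiv ℝ F q v) := fun v =>
    ((hF.continuous_fderiv one_ne_zero).clm_apply continuous_const).integrable_of_hasCompactSupport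
      (hc.fderiv_apply ℝ v)
  have hm : ∀ a v : ℍ[ℝ], Integrable (fun q => a * fderiv ℝ F q v) := fun a v =>
    (hi v).const_mul a
  have hz : ∀ a v : ℍ[ℝ], ∫ q, a * fderiv ℝ F q v = 0 := fun a v => by
    rw [integral_const_mul_of_integrable (hi v), integral_fderiv_apply_eq_zero hF hc, mul_zero]
  refine ⟨(((hi 1).add (hm _ _)).add (hm _ _)).add (hm _ _), ?_⟩
  unfold Dl
  rw [integral_add (by fun_prop) (by fun_prop), integral_add (by fun_prop) (by fun_prop),
    integral_add (by fun_prop) (by fun_prop), integral_fderiv_apply_eq_zero hF hc, hz, hz, hz]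
  simp

theorem continuousOn_Dl {Ω : Set ℍ[ℝ]} (hΩ : IsOpen Ω) {f : ℍ[ℝ] → ℍ[ℝ]}
    (hf : ContDiffOn ℝ 1 f Ω) : ContinuousOn (Dl f) Ω := by
  have h : ContinuousOn (fderiv ℝ f) Ω := hf.continuousOn_fderiv_of_isOpen hΩ le_rfl
  unfold Dl
  fun_prop

theorem continuousOn_cullen {Ω : Set ℍ[ℝ]} (hΩ : IsOpen Ω) (hplane : ∀ q ∈ Ω, q ∉ tkPlane)
    {f : ℍ[ℝ] → ℍ[ℝ]} (hf : ContDiffOn ℝ 1 f Ω) : ContinuousOn (cullen f) Ω := by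
  have h : ContinuousOn (fderiv ℝ f) Ω := hf.continuousOn_fderiv_of_isOpen hΩ le_rfl
  have hr : ContinuousOn rQ Ω := Quaternion.continuous_im.norm.continuousOn
  have hi : ContinuousOn iotaQ Ω :=
    (hr.inv₀ fun q hq => rQ_ne_zero (hplane q hq)).smul Quaternion.continuous_im.continuousOn
  unfold cullen
  fun_prop

/-- Integration by parts for the Fueter operators, against a real test function. -/
theorem integral_Dr_smul_one_mul {Ω : Set ℍ[ℝ]} (hΩ : IsOpen Ω) {f : ℍ[ℝ] → ℍ[ℝ]}
    (hf : ContDiffOn ℝ 1 f Ω) {u : ℍ[ℝ] → ℝ} (hu : ContDiff ℝ 1 u) (hc : HasCompactSupport u)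
    (hs : tsupport u ⊆ Ω) :
    ∫ q in Ω, Dr (fun p => u p • (1 : ℍ[ℝ])) q * f q = -∫ q in Ω, u q • Dl f q := by
  have hF := contDiff_smul_of_contDiffOn hΩ hu hs hf
  have hFc : HasCompactSupport fun q => u q • f q := hc.smul_right
  obtain ⟨hi, hz⟩ := integrable_Dl hF hFc
  have hD := integrable_smul_of_continuousOn hΩ hu.continuous hc hs (continuousOn_Dl hΩ hf)
  have hzΩ : ∫ q in Ω, Dl (fun q => u q • f q) q = 0 := by
    rw [setIntegral_eq_integral_of_forall_compl_eq_zero, hz]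
    intro q hq
    have : fderiv ℝ (fun q => u q • f q) q = 0 := by
      refine image_eq_zero_of_notMem_tsupport fun hq' => hq ?_
      exact hs (tsupport_smul_subset_left u f (tsupport_fderiv_subset ℝ hq'))
    simp [Dl, this]
  calc ∫ q in Ω, Dr (fun p => u p • (1 : ℍ[ℝ])) q * f q
      = ∫ q in Ω, (Dl (fun q => u q • f q) q - u q • Dl f q) := by
        refine setIntegral_congr_fun hΩ.measurableSet fun q hq => ?_
        have hfq : DifferentiableAt ℝ f q :=
          (hf.contDiffAt (hΩ.mem_nhds hq)).differentiableAt one_ne_zero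
        simp only [Dl_smul (hu.differentiable one_ne_zero q) hfq, add_sub_cancel_right]
    _ = -∫ q in Ω, u q • Dl f q := by
        rw [integral_sub hi.integrableOn hD.integrableOn, hzΩ, zero_sub]

theorem isTestFunction_smul_one {Ω : Set ℍ[ℝ]} {u : ℍ[ℝ] → ℝ}
    (hu : ContDiff ℝ (⊤ : ℕ∞) u) (hc : HasCompactSupport u) (hs : tsupport u ⊆ Ω) :
    IsTestFunction (fun q => u q • (1 : ℍ[ℝ])) Ω where
  smooth := hu.smul contDiff_const
  compact_supp := hc.smul_right
  supp_subset := (tsupport_smul_subset_left u _).trans hs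

/-- **Semi-weak C-regular `C¹` functions are C-regular.** -/
theorem semiweak_C_regular_is_C_regular (Ω : Set ℍ[ℝ]) (hΩ : IsOpen Ω)
    (hΩb : Bornology.IsBounded Ω) (hplane : Disjoint (closure Ω) tkPlane)
    (f : ℍ[ℝ] → ℍ[ℝ]) (hf : ContDiffOn ℝ 1 f Ω)
    (hsemiweak : ∀ φ : ℍ[ℝ] → ℍ[ℝ], IsTestFunction φ Ω →
      ∫ q in Ω, Dr φ q * f q = ∫ q in Ω, φ q * ((rQ q)⁻¹ • dIota f q)) :
    ∀ q ∈ Ω, fderiv ℝ f q 1 + iotaQ q * fderiv ℝ f q (iotaQ q) = 0 := by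
  have hp : ∀ q ∈ Ω, q ∉ tkPlane := fun q hq =>
    Set.disjoint_left.mp hplane (subset_closure hq)
  have hcont := continuousOn_cullen hΩ hp hf
  have hae : ∀ᵐ q, q ∈ Ω → cullen f q = 0 := by
    refine hΩ.ae_eq_zero_of_integral_contDiff_smul_eq_zero
      (hcont.locallyIntegrableOn hΩ.measurableSet) fun u hu hc hs => ?_
    have hu1 : ContDiff ℝ 1 u := hu.of_le (by exact_mod_cast le_top)
    have hw := hsemiweak _ (isTestFunction_smul_one hu hc hs)
    rw [integral_Dr_smul_one_mul hΩ hf hu1 hc hs] at hw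
    have hC := integrable_smul_of_continuousOn hΩ hu1.continuous hc hs hcont
    have hD := integrable_smul_of_continuousOn hΩ hu1.continuous hc hs (continuousOn_Dl hΩ hf)
    have hd : ∫ q in Ω, (u q • (1 : ℍ[ℝ])) * ((rQ q)⁻¹ • dIota f q) =
        ∫ q in Ω, (u q • cullen f q - u q • Dl f q) := by
      refine setIntegral_congr_fun hΩ.measurableSet fun q hq => ?_
      simp only [cullen_eq_Dl_add (hp q hq), smul_add, smul_mul_assoc, one_mul,
        add_sub_cancel_left]
    rw [hd, integral_sub hC.integrableOn hD.integrableOn,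
      setIntegral_eq_integral_of_forall_compl_eq_zero (f := fun q => u q • cullen f q)] at hw
    · exact left_eq_add.mp (by rw [← sub_eq_neg_add]; simpa using hw)
    · intro q hq
      rw [image_eq_zero_of_notMem_tsupport fun h => hq (hs h), zero_smul]
  exact Measure.eqOn_open_of_ae_eq ((ae_restrict_iff' hΩ.measurableSet).mpr hae) hΩ hcont
    continuousOn_const
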